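/- arXiv:1910.03708 — 8 statements merged into one kernel-verified Lean document; each statement's English description precedes it below -/
import Mathlib

section
/- Let a, b, c ∈ ℝ with b·c ≠ 0, and let E be the 2-dimensional real evolution algebra with structure matrix [[a, b], [c, 0]] (i.e. e_1·e_1 = a e_1 + b e_2, e_2·e_2 = c e_1, e_1·e_2 = e_2·e_1 = 0). Then E is not right nilpotent; however, for every x = (x_1, x_2) ∈ ℝ² with x_1 = 0, the approximation E_x, namely the evolution algebra with structure matrix [[2a x_1, 2b x_1], [2c x_2, 0]] = [[0, 0], [2c x_2, 0]], is right nilpotent. -/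
open Matrix BigOperators

/-- Multiplication of the evolution algebra on `Fin n → ℝ` with structure matrix `M`. -/
def evolMul {n : ℕ} (M : Matrix (Fin n) (Fin n) ℝ) (u v : Fin n → ℝ) : Fin n → ℝ :=
  fun k => ∑ i, u i * v i * M i k

/-- The sequence `E^{<s>}` (indexed so that `evolRightPow M (s-1) = E^{<s>}`). -/
def evolRightPow {n : ℕ} (M : Matrix (Fin n) (Fin n) ℝ) : ℕ → Submodule ℝ (Fin n → ℝ)
  | 0 => ⊤
  | k + 1 => Submodule.span ℝ {w | ∃ u ∈ evolRightPow M k, ∃ v, w = evolMul M u v}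

/-- An evolution algebra is right nilpotent if `E^{<s>} = 0` for some `s ≥ 1`. -/
def RightNilpotent {n : ℕ} (M : Matrix (Fin n) (Fin n) ℝ) : Prop :=
  ∃ s : ℕ, evolRightPow M s = ⊥

theorem evolMul_one_left {n : ℕ} (M : Matrix (Fin n) (Fin n) ℝ) (v : Fin n → ℝ) :
    evolMul M 1 v = v ᵥ* M := by
  ext k
  simp [evolMul, vecMul, dotProduct]

theorem evolRightPow_eq_top_of_isUnit {n : ℕ} {M : Matrix (Fin n) (Fin n) ℝ} (hM : IsUnit M)
    (k : ℕ) : evolRightPow M k = ⊤ := by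
  induction k with
  | zero => rfl
  | succ k ih =>
    refine Submodule.eq_top_iff'.2 fun w => Submodule.subset_span ?_
    obtain ⟨v, hv⟩ := vecMul_surjective_iff_isUnit.2 hM w
    exact ⟨1, by simp [ih], v, by rw [evolMul_one_left]; exact hv.symm⟩

theorem not_rightNilpotent_of_isUnit {n : ℕ} [NeZero n] {M : Matrix (Fin n) (Fin n) ℝ}
    (hM : IsUnit M) : ¬ RightNilpotent M := by
  rintro ⟨s, hs⟩
  rw [evolRightPow_eq_top_of_isUnit hM] at hs
  exact top_ne_bot hs

theorem rightNilpotent_of_single_entry (d : ℝ) : RightNilpotent !![0, 0; d, 0] := by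
  have h_snd : ∀ u ∈ evolRightPow !![0, 0; d, 0] 1, u 1 = 0 := by
    intro u hu
    induction hu using Submodule.span_induction with
    | mem w hw =>
      obtain ⟨u, -, v, rfl⟩ := hw
      simp [evolMul]
    | zero => rfl
    | add u v _ _ hu hv => simp [hu, hv]
    | smul r u _ hu => simp [hu]
  refine ⟨2, Submodule.span_eq_bot.2 ?_⟩
  rintro w ⟨u, hu, v, rfl⟩
  ext k
  fin_cases k <;> simp [evolMul, h_snd u hu]

/-- For `b·c ≠ 0`, the evolution algebra with structure matrix
`[[a,b],[c,0]]` is not right nilpotent, yet for every `x` with `x 0 = 0` its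
approximation, the evolution algebra with structure matrix
`[[2a x₁, 2b x₁],[2c x₂, 0]]`, is right nilpotent. -/
theorem stmt3 (a b c : ℝ) (hbc : b * c ≠ 0) :
    ¬ RightNilpotent !![a, b; c, 0] ∧
    ∀ x : Fin 2 → ℝ, x 0 = 0 →
      RightNilpotent !![2 * a * x 0, 2 * b * x 0; 2 * c * x 1, 0] := by
  refine ⟨not_rightNilpotent_of_isUnit ?_, fun x hx => ?_⟩
  · rw [isUnit_iff_isUnit_det, det_fin_two_of]
    simpa using hbc
  · simpa [hx] using rightNilpotent_of_single_entry (2 * c * x 1)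
end

section
/- Let a, d ∈ ℝ with a·d ≠ 0. Let E be the 2-dimensional real evolution algebra with structure matrix [[1, 2], [3, 4]] and E' the 2-dimensional real evolution algebra with structure matrix [[a, 3a²/(16d)], [8d²/a, d]]. Then: (i) E and E' are isomorphic; (ii) if moreover a·d < 0, then for all nonzero x = (x_1, x_2) ∈ ℝ² and all nonzero y = (y_1, y_2) ∈ ℝ², the evolution algebra E_x with structure matrix [[x_1, 3x_2], [2x_1, 4x_2]] and the evolution algebra E'_y with structure matrix [[a y_1, (8d²/a) y_2], [(3a²/16d) y_1, d y_2]] are not isomorphic. -/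
open Matrix BigOperators

/-- Two evolution algebras (given by structure matrices) are isomorphic if there is a
bijective linear map `φ` with `φ (u·v) = φ u · φ v`. -/
def EvolIso {n : ℕ} (M N : Matrix (Fin n) (Fin n) ℝ) : Prop :=
  ∃ φ : (Fin n → ℝ) ≃ₗ[ℝ] (Fin n → ℝ),
    ∀ u v, φ (evolMul M u v) = evolMul N (φ u) (φ v)

theorem fst_eq_zero_of_mul_sq_eq {a r c k s t : ℝ} (har : a * r < 0) (hc : 0 < c) (hk : 0 < k)
    (h : c * (a * s ^ 2) = k * (r * t ^ 2)) : s = 0 := by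
  have ha : a ≠ 0 := fun ha => by simp [ha] at har
  have h1 : c * (a * s) ^ 2 = k * ((a * r) * t ^ 2) := by linear_combination a * h
  have h2 : k * ((a * r) * t ^ 2) ≤ 0 :=
    mul_nonpos_of_nonneg_of_nonpos hk.le (mul_nonpos_of_nonpos_of_nonneg har.le (sq_nonneg t))
  have h3 : (a * s) ^ 2 ≤ 0 := by
    by_contra! hlt
    have := mul_pos hc hlt
    linarith
  have h4 : a * s = 0 := pow_eq_zero_iff two_ne_zero |>.1 (le_antisymm h3 (sq_nonneg _))
  exact (mul_eq_zero.1 h4).resolve_left ha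

/-- The coordinate equations of a homomorphism `e₁ ↦ (α, β)`, `e₂ ↦ (γ, δ)` from `E_x` to an
algebra whose structure matrix is `[[a y₁, p y₂], [r y₁, d y₂]]` force the homomorphism to be
singular when `y₁ ≠ 0` and `a r < 0`. -/
theorem false_of_hom_equations {a r p d x₁ x₂ y₁ y₂ α β γ δ : ℝ}
    (har : a * r < 0) (hdet : a * d - p * r ≠ 0) (hx : x₁ ≠ 0 ∨ x₂ ≠ 0) (hy : y₁ ≠ 0)
    (hφ : α * δ - β * γ ≠ 0)
    (h₁₁ : x₁ * α + 3 * x₂ * γ = (a * α ^ 2 + r * β ^ 2) * y₁)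
    (h₁₂ : x₁ * β + 3 * x₂ * δ = (p * α ^ 2 + d * β ^ 2) * y₂)
    (h₂₁ : 2 * x₁ * α + 4 * x₂ * γ = (a * γ ^ 2 + r * δ ^ 2) * y₁)
    (h₂₂ : 2 * x₁ * β + 4 * x₂ * δ = (p * γ ^ 2 + d * δ ^ 2) * y₂)
    (h₀₁ : (a * (α * γ) + r * (β * δ)) * y₁ = 0)
    (h₀₂ : (p * (α * γ) + d * (β * δ)) * y₂ = 0) : False := by
  have ha : a ≠ 0 := fun ha => by simp [ha] at har
  have g₁ : a * (α * γ) + r * (β * δ) = 0 := (mul_eq_zero.1 h₀₁).resolve_right hy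
  have hβδ : β * δ = 0 := by
    by_cases hy₂ : y₂ = 0
    · subst hy₂
      have e₁ : x₁ * β = 0 := by linear_combination (-2) * h₁₂ + (3 / 2) * h₂₂
      have e₂ : x₂ * δ = 0 := by linear_combination h₁₂ - (1 / 2) * h₂₂
      rcases hx with hx | hx
      · simp [(mul_eq_zero.1 e₁).resolve_left hx]
      · simp [(mul_eq_zero.1 e₂).resolve_left hx]
    · have g₂ := (mul_eq_zero.1 h₀₂).resolve_right hy₂
      have : (a * d - p * r) * (β * δ) = 0 := by linear_combination a * g₂ - p * g₁
      exact (mul_eq_zero.1 this).resolve_left hdet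
  have hαγ : α * γ = 0 := by
    rw [hβδ, mul_zero, add_zero] at g₁
    exact (mul_eq_zero.1 g₁).resolve_left ha
  rcases mul_eq_zero.1 hβδ with rfl | rfl
  · have hα : α ≠ 0 := fun h => hφ (by rw [h]; ring)
    obtain rfl := (mul_eq_zero.1 hαγ).resolve_left hα
    refine hα (fst_eq_zero_of_mul_sq_eq (t := δ) har (c := 2) (k := 1) two_pos one_pos ?_)
    apply mul_right_cancel₀ hy
    linear_combination h₂₁ - 2 * h₁₁
  · have hγ : γ ≠ 0 := fun h => hφ (by rw [h]; ring)
    obtain rfl := (mul_eq_zero.1 hαγ).resolve_right hγ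
    refine hγ (fst_eq_zero_of_mul_sq_eq (t := β) har (c := 3) (k := 4) three_pos four_pos ?_)
    apply mul_right_cancel₀ hy
    linear_combination 4 * h₁₁ - 3 * h₂₁

theorem LinearEquiv.fin_two_det_ne_zero (φ : (Fin 2 → ℝ) ≃ₗ[ℝ] (Fin 2 → ℝ)) :
    φ ![1, 0] 0 * φ ![0, 1] 1 - φ ![1, 0] 1 * φ ![0, 1] 0 ≠ 0 := by
  have h := (LinearEquiv.isUnit_det' φ).ne_zero
  rw [← LinearMap.det_toMatrix', Matrix.det_fin_two] at h
  have e₀ : (Pi.single 0 1 : Fin 2 → ℝ) = ![1, 0] := by ext i; fin_cases i <;> simp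
  have e₁ : (Pi.single 1 1 : Fin 2 → ℝ) = ![0, 1] := by ext i; fin_cases i <;> simp
  simp only [LinearMap.toMatrix'_apply, e₀, e₁, LinearEquiv.coe_coe] at h
  intro h'
  exact h (by linear_combination h')

theorem LinearEquiv.fin_two_apply (φ : (Fin 2 → ℝ) ≃ₗ[ℝ] (Fin 2 → ℝ)) (w : Fin 2 → ℝ)
    (k : Fin 2) : φ w k = w 0 * φ ![1, 0] k + w 1 * φ ![0, 1] k := by
  have hw : w = w 0 • ![1, 0] + w 1 • ![0, 1] := by ext i; fin_cases i <;> simp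
  conv_lhs => rw [hw, map_add, map_smul, map_smul]
  simp

theorem not_evolIso_of_mul_neg {a r p d : ℝ} (har : a * r < 0) (hdp : d * p < 0)
    (hdet : a * d - p * r ≠ 0) {x y : Fin 2 → ℝ} (hx : x ≠ 0) (hy : y ≠ 0) :
    ¬ EvolIso !![x 0, 3 * x 1; 2 * x 0, 4 * x 1] !![a * y 0, p * y 1; r * y 0, d * y 1] := by
  rintro ⟨φ, hφ⟩
  have hx' : x 0 ≠ 0 ∨ x 1 ≠ 0 := by
    by_contra! h
    exact hx (by ext i; fin_cases i <;> simp [h])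
  have hy' : y 0 ≠ 0 ∨ y 1 ≠ 0 := by
    by_contra! h
    exact hy (by ext i; fin_cases i <;> simp [h])
  have hdφ := φ.fin_two_det_ne_zero
  have key := fun u v k => congrFun (hφ u v) k
  simp only [φ.fin_two_apply (evolMul _ _ _)] at key
  have k₁₁ := key ![1, 0] ![1, 0] 0
  have k₁₂ := key ![1, 0] ![1, 0] 1
  have k₂₁ := key ![0, 1] ![0, 1] 0
  have k₂₂ := key ![0, 1] ![0, 1] 1
  have k₀₁ := key ![1, 0] ![0, 1] 0
  have k₀₂ := key ![1, 0] ![0, 1] 1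
  generalize φ ![1, 0] = u at *
  generalize φ ![0, 1] = v at *
  simp [evolMul, Fin.sum_univ_two] at k₁₁ k₁₂ k₂₁ k₂₂ k₀₁ k₀₂
  rcases hy' with h | h
  · apply false_of_hom_equations (x₁ := x 0) (x₂ := x 1) (y₁ := y 0) (y₂ := y 1)
      (α := u 0) (β := u 1) (γ := v 0) (δ := v 1) har hdet hx' h hdφ
    · linear_combination k₁₁
    · linear_combination k₁₂
    · linear_combination k₂₁
    · linear_combination k₂₂
    · linear_combination -k₀₁
    · linear_combination -k₀₂
  · apply false_of_hom_equations (x₁ := x 0) (x₂ := x 1) (y₁ := y 1) (y₂ := y 0)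
      (α := u 1) (β := u 0) (γ := v 1) (δ := v 0) hdp (p := r) (d := a)
      (fun h' => hdet (by linear_combination h')) hx' h
      (fun h' => hdφ (by linear_combination -h'))
    · linear_combination k₁₂
    · linear_combination k₁₁
    · linear_combination k₂₂
    · linear_combination k₂₁
    · linear_combination -k₀₂
    · linear_combination -k₀₁

/-- The linear automorphism `(w₀, w₁) ↦ (t w₁, s w₀)` of `ℝ²`. -/
noncomputable def swapScaleEquiv (s t : ℝ) (hs : s ≠ 0) (ht : t ≠ 0) :
    (Fin 2 → ℝ) ≃ₗ[ℝ] (Fin 2 → ℝ) where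
  toFun w := ![t * w 1, s * w 0]
  map_add' u v := by ext i; fin_cases i <;> simp [mul_add]
  map_smul' c u := by ext i; fin_cases i <;> simp [mul_left_comm]
  invFun w := ![s⁻¹ * w 1, t⁻¹ * w 0]
  left_inv w := by ext i; fin_cases i <;> simp [hs, ht]
  right_inv w := by ext i; fin_cases i <;> simp [hs, ht]

/-- For `a·d ≠ 0`, the evolution algebras `E` and `E'` with structure
matrices `[[1,2],[3,4]]` and `[[a, 3a²/(16d)],[8d²/a, d]]` are isomorphic; and if
`a·d < 0` then for all nonzero `x, y ∈ ℝ²` the approximations `E_x` and `E'_y`, with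
the indicated structure matrices, are not isomorphic. -/
theorem stmt4 (a d : ℝ) (had : a * d ≠ 0) :
    EvolIso !![(1 : ℝ), 2; 3, 4] !![a, 3 * a ^ 2 / (16 * d); 8 * d ^ 2 / a, d] ∧
    (a * d < 0 →
      ∀ x y : Fin 2 → ℝ, x ≠ 0 → y ≠ 0 →
        ¬ EvolIso !![x 0, 3 * x 1; 2 * x 0, 4 * x 1]
            !![a * y 0, (8 * d ^ 2 / a) * y 1; (3 * a ^ 2 / (16 * d)) * y 0, d * y 1]) := by
  have ha : a ≠ 0 := left_ne_zero_of_mul had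
  have hd : d ≠ 0 := right_ne_zero_of_mul had
  refine ⟨⟨swapScaleEquiv (1 / d) (4 / a) (by positivity) (by positivity), fun u v => ?_⟩,
    fun hneg x y hx hy => not_evolIso_of_mul_neg ?_ ?_ ?_ hx hy⟩
  · ext i
    fin_cases i <;> simp [swapScaleEquiv, evolMul, Fin.sum_univ_two] <;> field_simp <;> ring
  · have h : a * (3 * a ^ 2 / (16 * d)) = (a * d) * (3 * a ^ 2 / (16 * d ^ 2)) := by
      field_simp
    rw [h]
    exact mul_neg_of_neg_of_pos hneg (by positivity)
  · have h : d * (8 * d ^ 2 / a) = (a * d) * (8 * d ^ 2 / a ^ 2) := by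
      field_simp
    rw [h]
    exact mul_neg_of_neg_of_pos hneg (by positivity)
  · have h : a * d - 8 * d ^ 2 / a * (3 * a ^ 2 / (16 * d)) = -(a * d) / 2 := by
      field_simp
      ring
    rw [h]
    exact div_ne_zero (neg_ne_zero.2 had) two_ne_zero
end

section
/- Let μ₁ be the 2-dimensional real Leibniz algebra with basis e_1, e_2 and bracket determined by [e_1, e_1] = e_2 (all other products of basis elements zero), with structure constants γ_{ij,k}. For x = (x_1, x_2) ∈ ℝ², the transposed approximation E^T_{μ₁,x} (the evolution algebra with structure matrix (β_{pk}(x))_{p,k}, β_{pk}(x) = Σ_i (γ_{ki,p} + γ_{ik,p}) x_i, which equals [[0,0],[2x_1,0]]) satisfies: (i) if x_1 = 0 then E^T_{μ₁,x} has zero multiplication (is abelian); (ii) if x_1 ≠ 0 then E^T_{μ₁,x} is isomorphic to the 2-dimensional evolution algebra E_4 with structure matrix [[0,1],[0,0]] (i.e. e_1·e_1 = e_2, e_2·e_2 = 0). -/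
open Matrix BigOperators

theorem evolMul_lower (c : ℝ) (u v : Fin 2 → ℝ) :
    evolMul !![0, 0; c, 0] u v = ![u 1 * v 1 * c, 0] := by
  ext k
  fin_cases k <;> simp [evolMul]

theorem evolMul_upper (c : ℝ) (u v : Fin 2 → ℝ) :
    evolMul !![0, c; 0, 0] u v = ![0, u 0 * v 0 * c] := by
  ext k
  fin_cases k <;> simp [evolMul]

theorem evolIso_lower_upper {c : ℝ} (hc : c ≠ 0) :
    EvolIso !![0, 0; c, 0] !![0, 1; 0, 0] := by
  let φ : (Fin 2 → ℝ) ≃ₗ[ℝ] (Fin 2 → ℝ) :=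
    { toFun := fun u => ![u 1, u 0 / c]
      invFun := fun w => ![c * w 1, w 0]
      map_add' := fun u v => by ext k; fin_cases k <;> simp [add_div]
      map_smul' := fun a u => by ext k; fin_cases k <;> simp [mul_div_assoc]
      left_inv := fun u => by ext k; fin_cases k <;> simp [mul_div_cancel₀, hc]
      right_inv := fun w => by ext k; fin_cases k <;> simp [hc] }
  have hφ (u : Fin 2 → ℝ) : φ u = ![u 1, u 0 / c] := rfl
  refine ⟨φ, fun u v => ?_⟩
  rw [evolMul_lower, evolMul_upper]
  simp [hφ, hc]

/-- Let `μ₁` be the 2-dimensional real Leibniz algebra with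
`[e₁,e₁] = e₂` and all other products of basis elements zero, with structure
constants `γ`. Its transposed approximation at `x`, the evolution algebra with
structure matrix `(∑ i, (γ k i p + γ i k p) * x i)_{p,k} = [[0,0],[2x₁,0]]`, is
abelian (zero multiplication) if `x₁ = 0`, and is isomorphic to `E₄`
(structure matrix `[[0,1],[0,0]]`) if `x₁ ≠ 0`. -/
theorem stmt9 (γ : Fin 2 → Fin 2 → Fin 2 → ℝ)
    (hγ : γ = fun i j k => if i = 0 ∧ j = 0 ∧ k = 1 then 1 else 0)
    (x : Fin 2 → ℝ) :
    (Matrix.of fun p k => ∑ i, (γ k i p + γ i k p) * x i) = !![0, 0; 2 * x 0, 0] ∧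
    (x 0 = 0 →
      ∀ u v, evolMul (Matrix.of fun p k => ∑ i, (γ k i p + γ i k p) * x i) u v = 0) ∧
    (x 0 ≠ 0 →
      EvolIso (Matrix.of fun p k => ∑ i, (γ k i p + γ i k p) * x i) !![0, 1; 0, 0]) := by
  have hM : (Matrix.of fun p k => ∑ i, (γ k i p + γ i k p) * x i) = !![0, 0; 2 * x 0, 0] := by
    subst hγ
    ext p k
    fin_cases p <;> fin_cases k <;> simp [one_add_one_eq_two]
  rw [hM]
  refine ⟨rfl, fun hx u v => ?_, fun hx => evolIso_lower_upper (mul_ne_zero two_ne_zero hx)⟩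
  rw [evolMul_lower, hx]
  simp
end

section
/- Let α ∈ ℝ and let λ₄(α) be the 3-dimensional real Leibniz algebra with basis e_1, e_2, e_3 and bracket determined by [e_1, e_1] = e_3, [e_2, e_2] = α e_3, [e_1, e_2] = e_3 (all other products of basis elements zero). For x = (x_1, x_2, x_3) ∈ ℝ³ with (2x_1 + x_2)(x_1 + 2α x_2) ≠ 0, the transposed approximation E^T_{λ₄(α),x} (the evolution algebra with structure matrix [[0,0,0],[0,0,0],[2x_1+x_2, x_1+2αx_2, 0]]) is isomorphic to the 3-dimensional evolution algebra with structure matrix [[0,1,1],[0,0,0],[0,0,0]] (i.e. e_1·e_1 = e_2 + e_3 and all other products of basis elements zero). -/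
open Matrix BigOperators

/-- If `a` and `b` are nonzero, the evolution algebra with `e₃·e₃ = a e₁ + b e₂` is isomorphic
to the one with `e₁·e₁ = e₂ + e₃` (all other products of basis elements being zero). -/
theorem evolIso_of_ne_zero {a b : ℝ} (ha : a ≠ 0) (hb : b ≠ 0) :
    EvolIso !![0, 0, 0; 0, 0, 0; a, b, 0] !![0, 1, 1; 0, 0, 0; 0, 0, 0] := by
  refine ⟨{ toFun := fun v => ![v 2, v 0 / a, v 1 / b]
            invFun := fun w => ![a * w 1, b * w 2, w 0]
            map_add' := fun u v => ?_
            map_smul' := fun c v => ?_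
            left_inv := fun v => ?_
            right_inv := fun w => ?_ }, fun u v => ?_⟩
  · ext i; fin_cases i <;> simp [add_div]
  · ext i; fin_cases i <;> simp [mul_div_assoc]
  · ext i; fin_cases i <;> simp <;> field_simp
  · ext i; fin_cases i <;> simp <;> field_simp
  · ext i; fin_cases i <;> simp [evolMul, Fin.sum_univ_three, ha, hb]

/-- Let `λ₄(α)` be the 3-dimensional real Leibniz algebra with
`[e₁,e₁] = e₃`, `[e₂,e₂] = α e₃`, `[e₁,e₂] = e₃` and all other products of basis
elements zero, with structure constants `γ`. For `(2x₁+x₂)(x₁+2αx₂) ≠ 0` its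
transposed approximation at `x`, the evolution algebra with structure matrix
`[[0,0,0],[0,0,0],[2x₁+x₂, x₁+2αx₂, 0]]`, is isomorphic to the evolution algebra
with structure matrix `[[0,1,1],[0,0,0],[0,0,0]]`. -/
theorem stmt12 (α : ℝ) (γ : Fin 3 → Fin 3 → Fin 3 → ℝ)
    (hγ : γ = fun i j k =>
      if i = 0 ∧ j = 0 ∧ k = 2 then 1
      else if i = 1 ∧ j = 1 ∧ k = 2 then α
      else if i = 0 ∧ j = 1 ∧ k = 2 then 1 else 0)
    (x : Fin 3 → ℝ) (hx : (2 * x 0 + x 1) * (x 0 + 2 * α * x 1) ≠ 0) :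
    (Matrix.of fun p k => ∑ i, (γ k i p + γ i k p) * x i) =
      !![0, 0, 0; 0, 0, 0; 2 * x 0 + x 1, x 0 + 2 * α * x 1, 0] ∧
    EvolIso (Matrix.of fun p k => ∑ i, (γ k i p + γ i k p) * x i)
      !![0, 1, 1; 0, 0, 0; 0, 0, 0] := by
  have hM : (Matrix.of fun p k => ∑ i, (γ k i p + γ i k p) * x i) =
      !![0, 0, 0; 0, 0, 0; 2 * x 0 + x 1, x 0 + 2 * α * x 1, 0] := by
    subst hγ
    ext p k
    fin_cases p <;> fin_cases k <;> simp [Fin.sum_univ_three, -mul_eq_mul_right_iff] <;> ring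
  refine ⟨hM, ?_⟩
  rw [hM]
  exact evolIso_of_ne_zero (left_ne_zero_of_mul hx) (right_ne_zero_of_mul hx)
end

section
/- Let α ∈ ℝ and let λ₄(α) be the 3-dimensional real Leibniz algebra with basis e_1, e_2, e_3 and bracket determined by [e_1, e_1] = e_3, [e_2, e_2] = α e_3, [e_1, e_2] = e_3 (all other products of basis elements zero). For x = (x_1, x_2, x_3) ∈ ℝ³ such that exactly one of the two numbers 2x_1 + x_2 and x_1 + 2α x_2 is zero, the transposed approximation E^T_{λ₄(α),x} (the evolution algebra with structure matrix [[0,0,0],[0,0,0],[2x_1+x_2, x_1+2αx_2, 0]]) is isomorphic to the 3-dimensional evolution algebra with structure matrix [[0,1,0],[0,0,0],[0,0,0]] (i.e. e_1·e_1 = e_2 and all other products of basis elements zero). -/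
open Matrix BigOperators

/-- Permuting the basis vectors and rescaling them by units gives isomorphic evolution algebras. -/
theorem EvolIso.of_perm_of_units {n : ℕ} {M N : Matrix (Fin n) (Fin n) ℝ}
    (σ : Equiv.Perm (Fin n)) (w : Fin n → ℝˣ)
    (h : ∀ i k, (w k : ℝ) * M (σ i) (σ k) = (w i : ℝ) ^ 2 * N i k) : EvolIso M N := by
  refine ⟨(LinearEquiv.funCongrLeft ℝ ℝ σ).trans
    (LinearEquiv.piCongrRight fun i => LinearEquiv.smulOfUnit (w i)), fun u v => ?_⟩
  funext k
  change (w k : ℝ) * ∑ i, u i * v i * M i (σ k) =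
    ∑ i, ((w i : ℝ) * u (σ i)) * ((w i : ℝ) * v (σ i)) * N i k
  rw [← Equiv.sum_comp σ, Finset.mul_sum]
  exact Finset.sum_congr rfl fun i _ => by linear_combination u (σ i) * v (σ i) * h i k

/-- Let `λ₄(α)` be the 3-dimensional real Leibniz algebra with
`[e₁,e₁] = e₃`, `[e₂,e₂] = α e₃`, `[e₁,e₂] = e₃` and all other products of basis
elements zero, with structure constants `γ`. If exactly one of `2x₁+x₂` and
`x₁+2αx₂` is zero, its transposed approximation at `x`, the evolution algebra with
structure matrix `[[0,0,0],[0,0,0],[2x₁+x₂, x₁+2αx₂, 0]]`, is isomorphic to the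
evolution algebra with structure matrix `[[0,1,0],[0,0,0],[0,0,0]]`. -/
theorem stmt13 (α : ℝ) (γ : Fin 3 → Fin 3 → Fin 3 → ℝ)
    (hγ : γ = fun i j k =>
      if i = 0 ∧ j = 0 ∧ k = 2 then 1
      else if i = 1 ∧ j = 1 ∧ k = 2 then α
      else if i = 0 ∧ j = 1 ∧ k = 2 then 1 else 0)
    (x : Fin 3 → ℝ)
    (hx : (2 * x 0 + x 1 = 0 ∧ x 0 + 2 * α * x 1 ≠ 0) ∨
          (2 * x 0 + x 1 ≠ 0 ∧ x 0 + 2 * α * x 1 = 0)) :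
    (Matrix.of fun p k => ∑ i, (γ k i p + γ i k p) * x i) =
      !![0, 0, 0; 0, 0, 0; 2 * x 0 + x 1, x 0 + 2 * α * x 1, 0] ∧
    EvolIso (Matrix.of fun p k => ∑ i, (γ k i p + γ i k p) * x i)
      !![0, 1, 0; 0, 0, 0; 0, 0, 0] := by
  have hM : (Matrix.of fun p k => ∑ i, (γ k i p + γ i k p) * x i) =
      !![0, 0, 0; 0, 0, 0; 2 * x 0 + x 1, x 0 + 2 * α * x 1, 0] := by
    subst hγ
    ext p k
    fin_cases p <;> fin_cases k <;> simp [Fin.sum_univ_three, ← two_mul]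
  refine ⟨hM, ?_⟩
  rw [hM]
  rcases hx with ⟨ha, hb⟩ | ⟨ha, hb⟩
  · rw [ha]
    refine EvolIso.of_perm_of_units (Equiv.swap 0 2) ![1, (Units.mk0 _ hb)⁻¹, 1] fun i k => ?_
    fin_cases i <;> fin_cases k <;> simp [Equiv.swap_apply_def, hb]
  · rw [hb]
    refine EvolIso.of_perm_of_units (Equiv.swap 0 2 * Equiv.swap 1 2)
      ![1, (Units.mk0 _ ha)⁻¹, 1] fun i k => ?_
    fin_cases i <;> fin_cases k <;> simp [Equiv.swap_apply_def, ha]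
end

section
/- Let λ₅ be the 3-dimensional real Leibniz algebra with basis e_1, e_2, e_3 and bracket determined by [e_2, e_1] = e_3 and [e_1, e_2] = e_3 (all other products of basis elements zero). For x = (x_1, x_2, x_3) ∈ ℝ³ with x_1 x_2 ≠ 0, the transposed approximation E^T_{λ₅,x} (the evolution algebra with structure matrix [[0,0,0],[0,0,0],[2x_2, 2x_1, 0]]) is isomorphic to the 3-dimensional evolution algebra with structure matrix [[0,1,1],[0,0,0],[0,0,0]] (i.e. e_1·e_1 = e_2 + e_3 and all other products of basis elements zero). -/
open Matrix BigOperators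

/-- Let `λ₅` be the 3-dimensional real Leibniz algebra with
`[e₂,e₁] = e₃`, `[e₁,e₂] = e₃` and all other products of basis elements zero, with
structure constants `γ`. For `x₁ x₂ ≠ 0` its transposed approximation at `x`, the
evolution algebra with structure matrix `[[0,0,0],[0,0,0],[2x₂, 2x₁, 0]]`, is
isomorphic to the evolution algebra with structure matrix
`[[0,1,1],[0,0,0],[0,0,0]]`. -/
theorem stmt14 (γ : Fin 3 → Fin 3 → Fin 3 → ℝ)
    (hγ : γ = fun i j k =>
      if i = 1 ∧ j = 0 ∧ k = 2 then 1
      else if i = 0 ∧ j = 1 ∧ k = 2 then 1 else 0)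
    (x : Fin 3 → ℝ) (hx : x 0 * x 1 ≠ 0) :
    (Matrix.of fun p k => ∑ i, (γ k i p + γ i k p) * x i) =
      !![0, 0, 0; 0, 0, 0; 2 * x 1, 2 * x 0, 0] ∧
    EvolIso (Matrix.of fun p k => ∑ i, (γ k i p + γ i k p) * x i)
      !![0, 1, 1; 0, 0, 0; 0, 0, 0] := by
  have hM : (Matrix.of fun p k => ∑ i, (γ k i p + γ i k p) * x i) =
      !![0, 0, 0; 0, 0, 0; 2 * x 1, 2 * x 0, 0] := by
    subst hγ
    ext p k
    fin_cases p <;> fin_cases k <;> simp [Fin.sum_univ_three, one_add_one_eq_two]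
  refine ⟨hM, ?_⟩
  rw [hM]
  exact evolIso_of_ne_zero (mul_ne_zero two_ne_zero (right_ne_zero_of_mul hx))
    (mul_ne_zero two_ne_zero (left_ne_zero_of_mul hx))
end

section
/- Let λ₅ be the 3-dimensional real Leibniz algebra with basis e_1, e_2, e_3 and bracket determined by [e_2, e_1] = e_3 and [e_1, e_2] = e_3 (all other products of basis elements zero). For x = (x_1, x_2, x_3) ∈ ℝ³ such that exactly one of x_1 and x_2 is zero, the transposed approximation E^T_{λ₅,x} (the evolution algebra with structure matrix [[0,0,0],[0,0,0],[2x_2, 2x_1, 0]]) is isomorphic to the 3-dimensional evolution algebra with structure matrix [[0,1,0],[0,0,0],[0,0,0]] (i.e. e_1·e_1 = e_2 and all other products of basis elements zero). -/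
open Matrix BigOperators

theorem evolIso_of_sq_eq_smul_fst {c : ℝ} (hc : c ≠ 0) :
    EvolIso !![0, 0, 0; 0, 0, 0; c, 0, 0] !![0, 1, 0; 0, 0, 0; 0, 0, 0] := by
  refine ⟨{ toFun := fun u => ![u 2, c⁻¹ * u 0, u 1]
            invFun := fun w => ![c * w 1, w 2, w 0]
            map_add' := fun u v => ?_
            map_smul' := fun r u => ?_
            left_inv := fun u => ?_
            right_inv := fun w => ?_ }, fun u v => ?_⟩
  all_goals
    ext k
    fin_cases k <;> simp [evolMul, Fin.sum_univ_three, hc, mul_add, mul_left_comm c⁻¹]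

theorem evolIso_of_sq_eq_smul_snd {c : ℝ} (hc : c ≠ 0) :
    EvolIso !![0, 0, 0; 0, 0, 0; 0, c, 0] !![0, 1, 0; 0, 0, 0; 0, 0, 0] := by
  refine ⟨{ toFun := fun u => ![u 2, c⁻¹ * u 1, u 0]
            invFun := fun w => ![w 2, c * w 1, w 0]
            map_add' := fun u v => ?_
            map_smul' := fun r u => ?_
            left_inv := fun u => ?_
            right_inv := fun w => ?_ }, fun u v => ?_⟩
  all_goals
    ext k
    fin_cases k <;> simp [evolMul, Fin.sum_univ_three, hc, mul_add, mul_left_comm c⁻¹]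

/-- Let `λ₅` be the 3-dimensional real Leibniz algebra with
`[e₂,e₁] = e₃`, `[e₁,e₂] = e₃` and all other products of basis elements zero, with
structure constants `γ`. If exactly one of `x₁, x₂` is zero, its transposed
approximation at `x`, the evolution algebra with structure matrix
`[[0,0,0],[0,0,0],[2x₂, 2x₁, 0]]`, is isomorphic to the evolution algebra with
structure matrix `[[0,1,0],[0,0,0],[0,0,0]]`. -/
theorem stmt15 (γ : Fin 3 → Fin 3 → Fin 3 → ℝ)
    (hγ : γ = fun i j k =>
      if i = 1 ∧ j = 0 ∧ k = 2 then 1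
      else if i = 0 ∧ j = 1 ∧ k = 2 then 1 else 0)
    (x : Fin 3 → ℝ) (hx : (x 0 = 0 ∧ x 1 ≠ 0) ∨ (x 0 ≠ 0 ∧ x 1 = 0)) :
    (Matrix.of fun p k => ∑ i, (γ k i p + γ i k p) * x i) =
      !![0, 0, 0; 0, 0, 0; 2 * x 1, 2 * x 0, 0] ∧
    EvolIso (Matrix.of fun p k => ∑ i, (γ k i p + γ i k p) * x i)
      !![0, 1, 0; 0, 0, 0; 0, 0, 0] := by
  have hM : (Matrix.of fun p k => ∑ i, (γ k i p + γ i k p) * x i) =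
      !![0, 0, 0; 0, 0, 0; 2 * x 1, 2 * x 0, 0] := by
    subst hγ
    ext p k
    fin_cases p <;> fin_cases k <;> simp +decide [Fin.sum_univ_three, one_add_one_eq_two]
  refine ⟨hM, ?_⟩
  rw [hM]
  rcases hx with ⟨h0, h1⟩ | ⟨h0, h1⟩
  · rw [h0, mul_zero]
    exact evolIso_of_sq_eq_smul_fst (mul_ne_zero two_ne_zero h1)
  · rw [h1, mul_zero]
    exact evolIso_of_sq_eq_smul_snd (mul_ne_zero two_ne_zero h0)
end

section
/- Let λ₆ be the 3-dimensional real Leibniz algebra with basis e_1, e_2, e_3 and bracket determined by [e_1, e_1] = e_2 and [e_2, e_1] = e_3 (all other products of basis elements zero). For x = (x_1, x_2, x_3) ∈ ℝ³ with x_2 = 0 and x_1 ≠ 0, the transposed approximation E^T_{λ₆,x} (the evolution algebra with structure matrix [[0,0,0],[2x_1,0,0],[0,x_1,0]]) is isomorphic to the 3-dimensional evolution algebra with structure matrix [[0,1,0],[0,0,1],[0,0,0]] (i.e. e_1·e_1 = e_2, e_2·e_2 = e_3, and all other products of basis elements zero). -/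
open Matrix BigOperators

/-- The linear automorphism of `ℝ³` sending `e₃ ↦ c e₁`, `e₂ ↦ c e₂`, `e₁ ↦ (c / 2) e₃`. -/
noncomputable def scaledReversal (c : ℝ) (hc : c ≠ 0) : (Fin 3 → ℝ) ≃ₗ[ℝ] (Fin 3 → ℝ) where
  toFun u := ![c * u 2, c * u 1, c / 2 * u 0]
  invFun v := ![2 / c * v 2, v 1 / c, v 0 / c]
  map_add' u v := by
    ext k
    fin_cases k <;> simp <;> ring
  map_smul' r u := by
    ext k
    fin_cases k <;> simp <;> ring
  left_inv u := by
    ext k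
    fin_cases k <;> simp <;> field_simp
  right_inv v := by
    ext k
    fin_cases k <;> simp <;> field_simp

theorem evolIso_of_ne_zero_s19 {c : ℝ} (hc : c ≠ 0) :
    EvolIso !![0, 0, 0; 2 * c, 0, 0; 0, c, 0] !![0, 1, 0; 0, 0, 1; 0, 0, 0] := by
  refine ⟨scaledReversal c hc, fun u v => ?_⟩
  ext k
  fin_cases k <;> simp [scaledReversal, evolMul, Fin.sum_univ_three] <;> ring

/-- Let `λ₆` be the 3-dimensional real Leibniz algebra with
`[e₁,e₁] = e₂`, `[e₂,e₁] = e₃` and all other products of basis elements zero, with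
structure constants `γ`. For `x₂ = 0`, `x₁ ≠ 0` its transposed approximation at `x`,
the evolution algebra with structure matrix `[[0,0,0],[2x₁,0,0],[0,x₁,0]]`, is
isomorphic to the evolution algebra with structure matrix
`[[0,1,0],[0,0,1],[0,0,0]]`. -/
theorem stmt19 (γ : Fin 3 → Fin 3 → Fin 3 → ℝ)
    (hγ : γ = fun i j k =>
      if i = 0 ∧ j = 0 ∧ k = 1 then 1
      else if i = 1 ∧ j = 0 ∧ k = 2 then 1 else 0)
    (x : Fin 3 → ℝ) (hx2 : x 1 = 0) (hx1 : x 0 ≠ 0) :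
    (Matrix.of fun p k => ∑ i, (γ k i p + γ i k p) * x i) =
      !![0, 0, 0; 2 * x 0, 0, 0; 0, x 0, 0] ∧
    EvolIso (Matrix.of fun p k => ∑ i, (γ k i p + γ i k p) * x i)
      !![0, 1, 0; 0, 0, 1; 0, 0, 0] := by
  have hM : (Matrix.of fun p k => ∑ i, (γ k i p + γ i k p) * x i) =
      !![0, 0, 0; 2 * x 0, 0, 0; 0, x 0, 0] := by
    ext p k
    subst hγ
    fin_cases p <;> fin_cases k <;> simp [Fin.sum_univ_three, hx2, one_add_one_eq_two]
  exact ⟨hM, hM ▸ evolIso_of_ne_zero_s19 hx1⟩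
end
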